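/- arXiv:2306.12238 — 2 statements merged into one kernel-verified Lean document; each statement's English description precedes it below -/
import Mathlib

section
/- Let U be a localisable f-algebra which is Dedekind complete and countably representable, and let u ∈ U with u ≥ 0. Then the supremum χ_{u=0} := sup{e ∈ U : e² = e and eu = 0} exists and is idempotent, and, setting χ_{u>0} := 1 − χ_{u=0}, there exist a countable partition (u_n)_{n∈ℕ} of χ_{u>0} and a sequence (w_n)_{n∈ℕ} of nonnegative elements of U such that u_n (u w_n − 1) = 0 for every n ∈ ℕ. -/
/-- An `f`-algebra: a Riesz space (real vector space with a lattice order, addition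
order-preserving, nonnegative scalar multiples of nonnegative elements nonnegative) endowed
with an associative, commutative, distributive multiplication with identity `1`, compatible
with scalar multiplication, such that products of nonnegative elements are nonnegative and
the `f`-condition holds: `(a * c) ⊓ b = 0` whenever `a ⊓ b = 0` and `0 ≤ c`. -/
class FAlgebra (A : Type*) extends Lattice A, CommRing A, Module ℝ A where
  add_le_add_left' : ∀ a b : A, a ≤ b → ∀ c : A, c + a ≤ c + b
  smul_nonneg' : ∀ (r : ℝ) (a : A), 0 ≤ r → 0 ≤ a → 0 ≤ r • a
  smul_mul' : ∀ (r : ℝ) (a b : A), r • (a * b) = (r • a) * b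
  mul_nonneg' : ∀ a b : A, 0 ≤ a → 0 ≤ b → 0 ≤ a * b
  f_cond : ∀ a b c : A, a ⊓ b = 0 → 0 ≤ c → (a * c) ⊓ b = 0

/-- A family of elements of an `f`-algebra is pairwise disjoint if `|e i| ⊓ |e j| = 0`
for all `i ≠ j`, where `|a| := a ⊔ -a`. -/
def PairwiseDisjointFam {A : Type*} [FAlgebra A] {ι : Type*} (e : ι → A) : Prop :=
  ∀ i j, i ≠ j → ((e i) ⊔ -(e i)) ⊓ ((e j) ⊔ -(e j)) = 0

/-- A simple element of an `f`-algebra: a finite real linear combination `∑ c i • e i`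
where `(e i)` is a finite partition of `1` (pairwise disjoint idempotents summing to `1`). -/
def IsSimpleElem {A : Type*} [FAlgebra A] (a : A) : Prop :=
  ∃ (n : ℕ) (c : Fin n → ℝ) (e : Fin n → A),
    (∀ i, e i * e i = e i) ∧ PairwiseDisjointFam e ∧ (∑ i, e i) = 1 ∧ a = ∑ i, c i • e i

/-- A localisable `f`-algebra: Dedekind σ-complete, with multiplication σ-order-continuous
on pairs of nonnegative elements, in which the simple elements are super-order-dense. -/
structure IsLocalisable (A : Type*) [FAlgebra A] : Prop where
  lub : ∀ S : Set A, S.Nonempty → S.Countable → BddAbove S → ∃ a, IsLUB S a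
  glb : ∀ S : Set A, S.Nonempty → S.Countable → BddBelow S → ∃ a, IsGLB S a
  mul_scont : ∀ (a b : ℕ → A) (x y : A), (∀ n, 0 ≤ a n) → (∀ n, 0 ≤ b n) →
    Monotone a → Monotone b → IsLUB (Set.range a) x → IsLUB (Set.range b) y →
    IsLUB (Set.range fun n => a n * b n) (x * y)
  simple_dense : ∀ x : A, 0 ≤ x → ∃ s : ℕ → A, Monotone s ∧ (∀ n, 0 ≤ s n) ∧
    (∀ n, IsSimpleElem (s n)) ∧ IsLUB (Set.range s) x

/-- A countable partition of an idempotent `u`: a sequence of pairwise disjoint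
idempotents whose supremum is `u`. -/
def IsCountablePartition {A : Type*} [FAlgebra A] (u : A) (e : ℕ → A) : Prop :=
  (∀ n, e n * e n = e n) ∧ PairwiseDisjointFam e ∧ IsLUB (Set.range e) u

/-- Dedekind completeness: every nonempty subset with an upper (resp. lower) bound has a
supremum (resp. an infimum). -/
def DedekindComplete (A : Type*) [FAlgebra A] : Prop :=
  (∀ S : Set A, S.Nonempty → BddAbove S → ∃ a, IsLUB S a) ∧
    (∀ S : Set A, S.Nonempty → BddBelow S → ∃ a, IsGLB S a)

/-- Countable representability: every nonempty subset with an upper (lower) bound admits a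
sequence of its elements whose supremum (infimum) is the supremum (infimum) of the set. -/
def CountablyRepresentable (A : Type*) [FAlgebra A] : Prop :=
  (∀ S : Set A, S.Nonempty → BddAbove S → ∃ (a : A) (s : ℕ → A),
      (∀ n, s n ∈ S) ∧ IsLUB S a ∧ IsLUB (Set.range s) a) ∧
    (∀ S : Set A, S.Nonempty → BddBelow S → ∃ (a : A) (s : ℕ → A),
      (∀ n, s n ∈ S) ∧ IsGLB S a ∧ IsGLB (Set.range s) a)

namespace FAlgebra

variable {A : Type*} [FAlgebra A]

instance : IsOrderedAddMonoid A where
  add_le_add_left a b h c := by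
    simpa only [add_comm] using FAlgebra.add_le_add_left' a b h c

theorem mul_le_mul_left_of_nonneg {a b c : A} (hc : 0 ≤ c) (h : a ≤ b) : c * a ≤ c * b := by
  have := FAlgebra.mul_nonneg' c (b - a) hc (sub_nonneg.2 h)
  rwa [mul_sub, sub_nonneg] at this

theorem mul_eq_zero_of_inf_eq_zero {a b : A} (hb : 0 ≤ b) (ha : 0 ≤ a) (h : a ⊓ b = 0) :
    a * b = 0 := by
  have h₁ := FAlgebra.f_cond a b b h hb
  rw [inf_comm] at h₁
  simpa [mul_comm b a] using FAlgebra.f_cond b (a * b) a h₁ ha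

theorem mul_self_nonneg (a : A) : 0 ≤ a * a := by
  have h : a⁺ * a⁻ = 0 :=
    mul_eq_zero_of_inf_eq_zero (negPart_nonneg a) (posPart_nonneg a) (posPart_inf_negPart_eq_zero a)
  have e : a * a = a⁺ * a⁺ + a⁻ * a⁻ := by
    conv_lhs => rw [← posPart_sub_negPart a]
    linear_combination (-2 : A) * h
  rw [e]
  exact add_nonneg (FAlgebra.mul_nonneg' _ _ (posPart_nonneg a) (posPart_nonneg a))
    (FAlgebra.mul_nonneg' _ _ (negPart_nonneg a) (negPart_nonneg a))

theorem idempotent_nonneg {e : A} (he : e * e = e) : 0 ≤ e := he ▸ mul_self_nonneg e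

theorem idempotent_compl {e : A} (he : e * e = e) : (1 - e) * (1 - e) = 1 - e := by
  linear_combination he

theorem idempotent_le_one {e : A} (he : e * e = e) : e ≤ 1 :=
  sub_nonneg.1 (idempotent_nonneg (idempotent_compl he))

theorem idempotent_mul_le {e a : A} (he : e * e = e) (ha : 0 ≤ a) : e * a ≤ a := by
  simpa [mul_comm] using mul_le_mul_left_of_nonneg ha (idempotent_le_one he)

theorem idempotent_le_of_mul_eq {e f : A} (hf : f * f = f) (h : e * f = e)
    (he : e * e = e) : e ≤ f := by
  rw [← h]; exact idempotent_mul_le he (idempotent_nonneg hf)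

theorem mul_eq_of_idempotent_le {e f : A} (he : e * e = e) (hf : f * f = f) (h : e ≤ f) :
    e * f = e := by
  have h₁ := mul_le_mul_left_of_nonneg (idempotent_nonneg he) h
  rw [he] at h₁
  refine le_antisymm ?_ h₁
  rw [mul_comm]
  exact idempotent_mul_le hf (idempotent_nonneg he)

theorem idempotent_inf_eq_zero {e f : A} (he : e * e = e) (hf : f * f = f) (h : e * f = 0) :
    e ⊓ f = 0 := by
  refine le_antisymm ?_ (le_inf (idempotent_nonneg he) (idempotent_nonneg hf))
  have h₁ := mul_le_mul_left_of_nonneg (idempotent_nonneg he) (inf_le_right : e ⊓ f ≤ f)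
  have h₂ := mul_le_mul_left_of_nonneg (idempotent_nonneg (idempotent_compl he))
    (inf_le_left : e ⊓ f ≤ e)
  have h₃ := add_le_add h₁ h₂
  have l : e * (e ⊓ f) + (1 - e) * (e ⊓ f) = e ⊓ f := by ring
  have r : e * f + (1 - e) * e = 0 := by linear_combination h - he
  rwa [l, r] at h₃

theorem sup_neg_eq_self {e : A} (he : 0 ≤ e) : e ⊔ -e = e :=
  sup_eq_left.2 ((neg_nonpos.2 he).trans he)

theorem smul_mul_smul (r t : ℝ) (a b : A) : (r • a) * (t • b) = (r * t) • (a * b) := by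
  rw [← FAlgebra.smul_mul', mul_comm a, ← FAlgebra.smul_mul', smul_smul, mul_comm b]

theorem sum_smul_mul_sum_smul {n : ℕ} {e : Fin n → A} (he : ∀ i, e i * e i = e i)
    (hd : PairwiseDisjointFam e) (c d : Fin n → ℝ) :
    (∑ i, c i • e i) * (∑ i, d i • e i) = ∑ i, (c i * d i) • e i := by
  rw [Finset.sum_mul_sum]
  refine Finset.sum_congr rfl fun i _ => ?_
  rw [Finset.sum_eq_single i, smul_mul_smul, he]
  · intro j _ hj
    have h := hd i j hj.symm
    have hi := idempotent_nonneg (he i)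
    have hj' := idempotent_nonneg (he j)
    rw [sup_neg_eq_self hi, sup_neg_eq_self hj'] at h
    rw [smul_mul_smul, mul_eq_zero_of_inf_eq_zero hj' hi h, smul_zero]
  · simp

/-- A nonnegative simple element has a nonnegative generalised inverse. -/
theorem exists_generalized_inverse {s : A} (hs : IsSimpleElem s) (h0 : 0 ≤ s) :
    ∃ w : A, 0 ≤ w ∧ s * w * s = s ∧ w * s * w = w := by
  obtain ⟨n, c, e, he, hd, -, rfl⟩ := hs
  have h₁ : (∑ i, (c i)⁻¹ • e i) * (∑ i, c i • e i) * (∑ i, (c i)⁻¹ • e i)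
      = ∑ i, (c i)⁻¹ • e i := by
    simp only [sum_smul_mul_sum_smul he hd]
    refine Finset.sum_congr rfl fun i _ => ?_
    rcases eq_or_ne (c i) 0 with h | h <;> simp [h]
  refine ⟨∑ i, (c i)⁻¹ • e i, ?_, ?_, h₁⟩
  · rw [← h₁, mul_right_comm]
    exact FAlgebra.mul_nonneg' _ _ (mul_self_nonneg _) h0
  · simp only [sum_smul_mul_sum_smul he hd]
    refine Finset.sum_congr rfl fun i _ => ?_
    rcases eq_or_ne (c i) 0 with h | h <;> simp [h]

theorem isLUB_const_sub {a : ℕ → A} {x : A} (c : A) (h : IsGLB (Set.range a) x) :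
    IsLUB (Set.range fun n => c - a n) (c - x) := by
  refine ⟨?_, fun b hb => ?_⟩
  · rintro _ ⟨n, rfl⟩
    exact sub_le_sub_left (h.1 ⟨n, rfl⟩) c
  · rw [sub_le_comm]
    refine h.2 ?_
    rintro _ ⟨n, rfl⟩
    rw [sub_le_comm]
    exact hb ⟨n, rfl⟩

theorem isLUB_sub_const {a : ℕ → A} {x : A} (c : A) (h : IsLUB (Set.range a) x) :
    IsLUB (Set.range fun n => a n - c) (x - c) := by
  refine ⟨?_, fun b hb => ?_⟩
  · rintro _ ⟨n, rfl⟩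
    exact sub_le_sub_right (h.1 ⟨n, rfl⟩) c
  · rw [sub_le_iff_le_add]
    refine h.2 ?_
    rintro _ ⟨n, rfl⟩
    rw [← sub_le_iff_le_add]
    exact hb ⟨n, rfl⟩

theorem isLUB_const_mul (hloc : IsLocalisable A) {a : ℕ → A} {x c : A} (hc : 0 ≤ c)
    (ha : ∀ n, 0 ≤ a n) (hm : Monotone a) (h : IsLUB (Set.range a) x) :
    IsLUB (Set.range fun n => c * a n) (c * x) :=
  hloc.mul_scont (fun _ => c) a c x (fun _ => hc) ha monotone_const hm
    (by rw [Set.range_const]; exact isLUB_singleton) h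

/-- If nonnegative elements `s k` increase to `u` and `v k ≥ 0` are inverse to `s k` on `e`,
decreasing in `k`, then `u` is invertible on `e`. -/
theorem exists_mul_eq_of_isLUB (hloc : IsLocalisable A) {s v : ℕ → A} {u e : A}
    (hs : Monotone s) (hs0 : ∀ k, 0 ≤ s k) (hu : IsLUB (Set.range s) u)
    (hv : Antitone v) (hv0 : ∀ k, 0 ≤ v k) (hsv : ∀ k, s k * v k = e) :
    ∃ w : A, 0 ≤ w ∧ u * w = e := by
  have hb : (0 : A) ∈ lowerBounds (Set.range v) := by
    rintro _ ⟨k, rfl⟩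
    exact hv0 k
  obtain ⟨w, hw⟩ := hloc.glb (Set.range v) (Set.range_nonempty v) (Set.countable_range v) ⟨0, hb⟩
  refine ⟨w, hw.2 hb, ?_⟩
  have h₁ := hloc.mul_scont s (fun k => v 0 - v k) u (v 0 - w) hs0
    (fun k => sub_nonneg.2 (hv (Nat.zero_le k))) hs
    (fun i j hij => sub_le_sub_left (hv hij) _) hu (isLUB_const_sub _ hw)
  have h₂ := isLUB_sub_const e (isLUB_const_mul hloc (hv0 0) hs0 hs hu)
  have h₃ : (fun k => s k * (v 0 - v k)) = fun k => v 0 * s k - e := by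
    funext k
    linear_combination -hsv k
  rw [h₃] at h₁
  linear_combination h₂.unique h₁

/-- The differences of an increasing sequence of idempotents partition its supremum. -/
theorem exists_countablePartition {e : ℕ → A} {x : A} (he : ∀ n, e n * e n = e n)
    (hm : Monotone e) (hx : IsLUB (Set.range e) x) :
    ∃ p : ℕ → A, IsCountablePartition x p ∧ ∀ n, p n * e n = p n := by
  have hmul : ∀ i j, i ≤ j → e i * e j = e i := fun i j hij =>
    mul_eq_of_idempotent_le (he i) (he j) (hm hij)
  let p : ℕ → A := fun n => Nat.casesOn n (e 0) fun k => e (k + 1) - e k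
  have hp : ∀ n, p n * p n = p n := by
    rintro (_ | n)
    · exact he 0
    · change (e (n + 1) - e n) * (e (n + 1) - e n) = e (n + 1) - e n
      linear_combination he (n + 1) + he n - 2 * hmul n (n + 1) n.le_succ
  have hpe : ∀ n, p n * e n = p n := by
    rintro (_ | n)
    · exact he 0
    · change (e (n + 1) - e n) * e (n + 1) = e (n + 1) - e n
      linear_combination he (n + 1) - hmul n (n + 1) n.le_succ
  have hep : ∀ n, e n * p (n + 1) = 0 := fun n => by
    change e n * (e (n + 1) - e n) = 0
    linear_combination hmul n (n + 1) n.le_succ - he n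
  have hlt : ∀ i j, i < j → p i * p j = 0 := by
    rintro i (_ | j) hij
    · exact absurd hij (Nat.not_lt_zero i)
    · linear_combination -p (j + 1) * hpe i - p i * p (j + 1) * hmul i j (Nat.le_of_lt_succ hij)
        + p i * e i * hep j
  have hne : ∀ i j, i ≠ j → p i * p j = 0 := fun i j hij => by
    rcases hij.lt_or_gt with h | h
    · exact hlt i j h
    · rw [mul_comm]
      exact hlt j i h
  refine ⟨p, ⟨hp, fun i j hij => ?_, ?_, fun b hb => hx.2 ?_⟩, hpe⟩
  · rw [sup_neg_eq_self (idempotent_nonneg (hp i)), sup_neg_eq_self (idempotent_nonneg (hp j))]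
    exact idempotent_inf_eq_zero (hp i) (hp j) (hne i j hij)
  · rintro _ ⟨n, rfl⟩
    exact (idempotent_le_of_mul_eq (he n) (hpe n) (hp n)).trans (hx.1 ⟨n, rfl⟩)
  · rintro _ ⟨n, rfl⟩
    induction n with
    | zero => exact hb ⟨0, rfl⟩
    | succ n ih =>
      have h₁ := inf_add_sup (e n) (p (n + 1))
      rw [idempotent_inf_eq_zero (he n) (hp (n + 1)) (hep n), zero_add] at h₁
      have h₂ : e n + p (n + 1) = e (n + 1) := add_sub_cancel (e n) (e (n + 1))
      rw [← h₂, ← h₁]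
      exact sup_le ih (hb ⟨n + 1, rfl⟩)

/-- Every `u ≥ 0` is invertible on each member of an increasing sequence of idempotents whose
joint complement annihilates `u`. -/
theorem exists_invertible_on_idempotents (hloc : IsLocalisable A) {u : A} (hu : 0 ≤ u) :
    ∃ (e w : ℕ → A) (x : A), (∀ n, e n * e n = e n) ∧ Monotone e ∧ (∀ n, 0 ≤ w n) ∧
      (∀ n, u * w n = e n) ∧ IsLUB (Set.range e) x ∧ x * x = x ∧ (1 - x) * u = 0 := by
  obtain ⟨s, hs, hs0, hsimple, hsu⟩ := hloc.simple_dense u hu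
  choose w hw0 hsws hwsw using fun n => exists_generalized_inverse (hsimple n) (hs0 n)
  have he : ∀ n, s n * w n * (s n * w n) = s n * w n := fun n => by
    linear_combination w n * hsws n
  have hstep : ∀ i j, i ≤ j → s i * (s j * w j) = s i := fun i j hij => by
    have h₁ := mul_le_mul_left_of_nonneg (idempotent_nonneg (idempotent_compl (he j))) (hs hij)
    have h₂ : (1 - s j * w j) * s j = 0 := by linear_combination -hsws j
    rw [h₂] at h₁
    have h₃ := le_antisymm h₁
      (FAlgebra.mul_nonneg' _ _ (idempotent_nonneg (idempotent_compl (he j))) (hs0 i))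
    linear_combination -h₃
  have hem : ∀ i j, i ≤ j → s i * w i * (s j * w j) = s i * w i := fun i j hij => by
    linear_combination w i * hstep i j hij
  have hmono : Monotone fun n => s n * w n := fun i j hij =>
    idempotent_le_of_mul_eq (he j) (hem i j hij) (he i)
  have hinv : ∀ n, ∃ v : A, 0 ≤ v ∧ u * v = s n * w n := fun n => by
    have hn0 := idempotent_nonneg (he n)
    refine exists_mul_eq_of_isLUB hloc (s := fun k => s (n + k))
      (v := fun k => w (n + k) * (s n * w n)) (fun i j hij => hs (Nat.add_le_add_left hij n))
      (fun k => hs0 _) ?_ ?_ (fun k => FAlgebra.mul_nonneg' _ _ (hw0 _) hn0) ?_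
    · refine ⟨?_, fun b hb => hsu.2 ?_⟩
      · rintro _ ⟨k, rfl⟩
        exact hsu.1 ⟨n + k, rfl⟩
      · rintro _ ⟨k, rfl⟩
        exact (hs (Nat.le_add_left k n)).trans (hb ⟨k, rfl⟩)
    · intro i j hij
      have hij' : n + i ≤ n + j := Nat.add_le_add_left hij n
      have hc : 0 ≤ w (n + j) * (w (n + i) * (s n * w n)) :=
        FAlgebra.mul_nonneg' _ _ (hw0 _) (FAlgebra.mul_nonneg' _ _ (hw0 _) hn0)
      have h₁ := mul_le_mul_left_of_nonneg hc (hs hij')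
      have h₂ := idempotent_mul_le (he (n + j)) (FAlgebra.mul_nonneg' _ _ (hw0 (n + i)) hn0)
      calc w (n + j) * (s n * w n) = w (n + j) * (w (n + i) * (s n * w n)) * s (n + i) := by
            linear_combination -w (n + j) * hem n (n + i) (Nat.le_add_right n i)
        _ ≤ w (n + j) * (w (n + i) * (s n * w n)) * s (n + j) := h₁
        _ = s (n + j) * w (n + j) * (w (n + i) * (s n * w n)) := by ring
        _ ≤ w (n + i) * (s n * w n) := h₂
    · intro k
      linear_combination hem n (n + k) (Nat.le_add_right n k)
  choose v hv0 huv using hinv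
  have hb : (1 : A) ∈ upperBounds (Set.range fun n => s n * w n) := by
    rintro _ ⟨n, rfl⟩
    exact idempotent_le_one (he n)
  obtain ⟨x, hx⟩ := hloc.lub _ (Set.range_nonempty fun n => s n * w n)
    (Set.countable_range _) ⟨1, hb⟩
  have hxx : x * x = x := by
    have h₁ := hloc.mul_scont _ _ x x (fun n => idempotent_nonneg (he n))
      (fun n => idempotent_nonneg (he n)) hmono hmono hx hx
    simp only [he] at h₁
    exact h₁.unique hx
  refine ⟨_, v, x, he, hmono, hv0, huv, hx, hxx, ?_⟩
  have h₁ := isLUB_const_mul hloc (idempotent_nonneg (idempotent_compl hxx)) hs0 hs hsu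
  have h₂ : (fun n => (1 - x) * s n) = fun _ => 0 := by
    funext n
    have h := mul_eq_of_idempotent_le (he n) hxx (hx.1 ⟨n, rfl⟩)
    linear_combination (x - 1) * hsws n - s n * h
  rw [h₂, Set.range_const] at h₁
  exact h₁.unique isLUB_singleton

end FAlgebra

/-- local inverses: in a Dedekind complete, countably representable
localisable `f`-algebra, for every `u ≥ 0` the supremum `χ₀` of all idempotents `e` with
`e * u = 0` exists and is idempotent, and there exist a countable partition `(p n)` of
`1 - χ₀` and nonnegative elements `(w n)` such that `p n * (u * w n - 1) = 0` for all `n`. -/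
theorem local_inverses {A : Type*} [FAlgebra A] (hloc : IsLocalisable A)
    (hdc : DedekindComplete A) (hcr : CountablyRepresentable A)
    (u : A) (hu : 0 ≤ u) :
    ∃ χ₀ : A, IsLUB {e : A | e * e = e ∧ e * u = 0} χ₀ ∧ χ₀ * χ₀ = χ₀ ∧
      ∃ (p w : ℕ → A), IsCountablePartition (1 - χ₀) p ∧ (∀ n, 0 ≤ w n) ∧
        ∀ n, p n * (u * w n - 1) = 0 := by
  obtain ⟨e, w, x, he, hm, hw, huw, hx, hxx, hxu⟩ :=
    FAlgebra.exists_invertible_on_idempotents hloc hu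
  obtain ⟨p, hp, hpe⟩ := FAlgebra.exists_countablePartition he hm hx
  refine ⟨1 - x, ⟨?_, fun b hb => hb ⟨FAlgebra.idempotent_compl hxx, hxu⟩⟩,
    FAlgebra.idempotent_compl hxx, p, w, by rwa [sub_sub_cancel], hw, fun n => ?_⟩
  · rintro f ⟨hf, hfu⟩
    rw [le_sub_comm]
    refine hx.2 ?_
    rintro _ ⟨n, rfl⟩
    refine FAlgebra.idempotent_le_of_mul_eq (FAlgebra.idempotent_compl hf) ?_ (he n)
    linear_combination f * huw n - w n * hfu
  · rw [huw, mul_sub, hpe, mul_one, sub_self]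
end

section
/- Let (X, 𝒜, μ) be a σ-finite measure space and let p ∈ [1, ∞]. Then Lᵖ(μ) is countably representable: for every nonempty set S ⊆ Lᵖ(μ) having an upper bound in Lᵖ(μ) there exist h ∈ Lᵖ(μ) and a sequence (f_n)_{n∈ℕ} of elements of S such that h is the least upper bound of S and h is also the least upper bound of {f_n : n ∈ ℕ}; dually, every nonempty subset of Lᵖ(μ) having a lower bound in Lᵖ(μ) has a greatest lower bound which is the greatest lower bound of a countable subfamily of the given set. -/
open MeasureTheory ENNReal

/-- If sequences that are bounded above have least upper bounds, and there is a strictly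
monotone real-valued function, then every nonempty set that is bounded above has a least upper
bound attained along a sequence in the set. -/
theorem exists_seq_isLUB_of_strictMono {α : Type*} [PartialOrder α]
    (hα : ∀ f : ℕ → α, BddAbove (Set.range f) → ∃ h, IsLUB (Set.range f) h)
    {Φ : α → ℝ} (hΦ : StrictMono Φ) {S : Set α} (hne : S.Nonempty) (hbdd : BddAbove S) :
    ∃ (h : α) (f : ℕ → α), (∀ n, f n ∈ S) ∧ IsLUB S h ∧ IsLUB (Set.range f) h := by
  obtain ⟨u, hu⟩ := hbdd
  obtain ⟨s₀, hs₀⟩ := hne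
  have hsup : ∀ f : ℕ → α, (∀ n, f n ∈ S) → ∃ h, IsLUB (Set.range f) h := fun f hf =>
    hα f ⟨u, by rintro _ ⟨n, rfl⟩; exact hu (hf n)⟩
  let T : Set α := {h | ∃ f : ℕ → α, (∀ n, f n ∈ S) ∧ IsLUB (Set.range f) h}
  have hTne : (Φ '' T).Nonempty := by
    obtain ⟨h, hh⟩ := hsup (fun _ => s₀) fun _ => hs₀
    exact ⟨Φ h, h, ⟨_, fun _ => hs₀, hh⟩, rfl⟩
  have hTbdd : BddAbove (Φ '' T) := by
    refine ⟨Φ u, ?_⟩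
    rintro _ ⟨h, ⟨f, hf, hh⟩, rfl⟩
    exact hΦ.monotone (hh.2 (by rintro _ ⟨n, rfl⟩; exact hu (hf n)))
  obtain ⟨v, -, hv, hvT⟩ := exists_seq_tendsto_sSup hTne hTbdd
  choose k hkT hkv using hvT
  choose F hFS hF using hkT
  have hGS : ∀ n, F (Nat.unpair n).1 (Nat.unpair n).2 ∈ S := fun n => hFS _ _
  obtain ⟨h, hh⟩ := hsup _ hGS
  have hkh : ∀ n, k n ≤ h := fun n => (hF n).2 <| by
    rintro _ ⟨m, rfl⟩
    exact hh.1 ⟨Nat.pair n m, by simp⟩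
  have hmax : sSup (Φ '' T) ≤ Φ h :=
    le_of_tendsto' hv fun n => hkv n ▸ hΦ.monotone (hkh n)
  refine ⟨h, _, hGS, ⟨fun s hs => ?_, fun w hw => hh.2 ?_⟩, hh⟩
  · have hHS : ∀ n, (Nat.casesOn n s fun m => F (Nat.unpair m).1 (Nat.unpair m).2 : α) ∈ S := by
      rintro (_ | n)
      exacts [hs, hGS n]
    obtain ⟨h', hh'⟩ := hsup _ hHS
    have hle : h ≤ h' := hh.2 <| by
      rintro _ ⟨n, rfl⟩
      exact hh'.1 ⟨n + 1, rfl⟩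
    have hΦle : Φ h' ≤ Φ h := (le_csSup hTbdd ⟨h', ⟨_, hHS, hh'⟩, rfl⟩).trans hmax
    have heq : h = h' := hle.eq_of_not_lt fun hlt => (hΦ hlt).not_ge hΦle
    exact heq ▸ hh'.1 ⟨0, rfl⟩
  · rintro _ ⟨n, rfl⟩
    exact hw (hGS n)

namespace MeasureTheory.Lp

variable {X : Type*} [MeasurableSpace X] {μ : Measure X} {p : ℝ≥0∞}

theorem exists_isLUB_range (f : ℕ → Lp ℝ p μ) (hf : BddAbove (Set.range f)) :
    ∃ h, IsLUB (Set.range f) h := by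
  obtain ⟨u, hu⟩ := hf
  have hfu : ∀ᵐ x ∂μ, ∀ n, f n x ≤ u x :=
    ae_all_iff.2 fun n => (coeFn_le _ _).2 (hu ⟨n, rfl⟩)
  have hmem : MemLp (fun x => ⨆ n, f n x) p μ := by
    refine MemLp.mono' ((Lp.memLp (f 0)).norm.add (Lp.memLp u).norm)
      (AEMeasurable.iSup fun n => (Lp.aestronglyMeasurable (f n)).aemeasurable).aestronglyMeasurable ?_
    filter_upwards [hfu] with x hx
    have h₀ : f 0 x ≤ ⨆ n, f n x := le_ciSup ⟨u x, by rintro _ ⟨n, rfl⟩; exact hx n⟩ 0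
    have h₁ : ⨆ n, f n x ≤ u x := ciSup_le hx
    simp only [Pi.add_apply, Real.norm_eq_abs]
    rw [abs_le]
    constructor
    · linarith [neg_abs_le (f 0 x), abs_nonneg (u x)]
    · linarith [le_abs_self (u x), abs_nonneg (f 0 x)]
  refine ⟨hmem.toLp _, ?_, fun w hw => ?_⟩
  · rintro _ ⟨n, rfl⟩
    rw [← coeFn_le]
    filter_upwards [hfu, hmem.coeFn_toLp] with x hx hx'
    rw [hx']
    exact le_ciSup (f := fun n => f n x) ⟨u x, by rintro _ ⟨n, rfl⟩; exact hx n⟩ n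
  · have hfw : ∀ᵐ x ∂μ, ∀ n, f n x ≤ w x :=
      ae_all_iff.2 fun n => (coeFn_le _ _).2 (hw ⟨n, rfl⟩)
    rw [← coeFn_le]
    filter_upwards [hfw, hmem.coeFn_toLp] with x hx hx'
    rw [hx']
    exact ciSup_le hx

theorem strictMono_integral_arctan [SFinite μ] :
    StrictMono fun h : Lp ℝ p μ => ∫ x, Real.arctan (h x) ∂μ.toFinite := by
  have hint : ∀ h : Lp ℝ p μ, Integrable (fun x => Real.arctan (h x)) μ.toFinite := fun h => by
    refine Integrable.of_bound (C := Real.pi / 2) (Real.continuous_arctan.comp_aestronglyMeasurable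
      ((Lp.aestronglyMeasurable h).mono_ac (toFinite_absolutelyContinuous μ))) ?_
    filter_upwards with x
    exact abs_le.2 ⟨(Real.neg_pi_div_two_lt_arctan _).le, (Real.arctan_lt_pi_div_two _).le⟩
  intro g h hgh
  have hle : (fun x => Real.arctan (g x)) ≤ᵐ[μ.toFinite] fun x => Real.arctan (h x) := by
    rw [Filter.EventuallyLE, ae_toFinite]
    filter_upwards [(coeFn_le _ _).2 hgh.le] with x hx
    exact Real.arctan_strictMono.monotone hx
  refine (integral_mono_ae (hint g) (hint h) hle).lt_of_ne fun heq => hgh.ne ?_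
  have hae := (integral_eq_iff_of_ae_le (hint g) (hint h) hle).1 heq
  rw [Filter.EventuallyEq, ae_toFinite] at hae
  refine Lp.ext ?_
  filter_upwards [hae] with x hx
  exact Real.arctan_injective hx

theorem exists_seq_isLUB [SFinite μ] {S : Set (Lp ℝ p μ)} (hne : S.Nonempty)
    (hbdd : BddAbove S) :
    ∃ (h : Lp ℝ p μ) (f : ℕ → Lp ℝ p μ),
      (∀ n, f n ∈ S) ∧ IsLUB S h ∧ IsLUB (Set.range f) h :=
  exists_seq_isLUB_of_strictMono exists_isLUB_range strictMono_integral_arctan hne hbdd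

end MeasureTheory.Lp

/-- for a σ-finite measure space `(X, 𝒜, μ)` and `p ∈ [1, ∞]`, the Lebesgue
space `Lᵖ(μ)` (with the a.e. order) is countably representable: every nonempty subset with
an upper bound in `Lᵖ(μ)` has a least upper bound which is also the least upper bound of a
countable subfamily, and dually for lower bounds. -/
theorem Lp_countably_representable {X : Type*} [MeasurableSpace X]
    (μ : Measure X) [SigmaFinite μ] (p : ℝ≥0∞) (hp : 1 ≤ p) :
    (∀ S : Set (Lp ℝ p μ), S.Nonempty → BddAbove S →
      ∃ (h : Lp ℝ p μ) (f : ℕ → Lp ℝ p μ),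
        (∀ n, f n ∈ S) ∧ IsLUB S h ∧ IsLUB (Set.range f) h) ∧
    (∀ S : Set (Lp ℝ p μ), S.Nonempty → BddBelow S →
      ∃ (h : Lp ℝ p μ) (f : ℕ → Lp ℝ p μ),
        (∀ n, f n ∈ S) ∧ IsGLB S h ∧ IsGLB (Set.range f) h) := by
  refine ⟨fun S => Lp.exists_seq_isLUB, fun S hne hbdd => ?_⟩
  obtain ⟨h, f, hf, hS, hr⟩ := Lp.exists_seq_isLUB hne.neg hbdd.neg
  refine ⟨-h, fun n => -f n, hf, isLUB_neg.1 hS, isLUB_neg.1 ?_⟩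
  have hrange : -Set.range (fun n => -f n) = Set.range f := by
    ext g
    simp
  rwa [hrange]
end
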